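/- arXiv:1305.3186 — 4 statements merged into one kernel-verified Lean document; each statement's English description precedes it below -/
import Mathlib

section
/- Let (X, μ) be a probabilistic modular space satisfying the Δ₂-condition with constant c > 0. If x and y are distinct points of X, then there exist t₀ > 0 and α₁ ∈ (0,1) with μ_{x−y}(t₀) < α₁ < 1 such that the μ-balls B(x, 1−α₁, t₀/(2c)) and B(y, 1−α₁, t₀/(2c)) are disjoint. In particular, distinct points of X can be separated by disjoint μ-balls. -/
open Set

/-- A probabilistic modular space structure on a real vector space `X`:
`mu x` is a nondecreasing function `ℝ → ℝ` with infimum 0 and supremum 1,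
satisfying the axioms of a probabilistic modular. -/
structure ProbModular (X : Type*) [AddCommGroup X] [Module ℝ X] where
  mu : X → ℝ → ℝ
  mono : ∀ x, Monotone (mu x)
  iInf_mu : ∀ x, ⨅ t : ℝ, mu x t = 0
  iSup_mu : ∀ x, ⨆ t : ℝ, mu x t = 1
  mu_zero : ∀ x, mu x 0 = 0
  mu_eq_one_iff : ∀ x, (∀ t : ℝ, 0 < t → mu x t = 1) ↔ x = 0
  mu_neg : ∀ x t, mu (-x) t = mu x t
  mu_convex : ∀ (x y : X) (a b s t : ℝ), 0 ≤ a → 0 ≤ b → a + b = 1 → 0 ≤ s → 0 ≤ t →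
    min (mu x s) (mu y t) ≤ mu (a • x + b • y) (s + t)

variable {X : Type*} [AddCommGroup X] [Module ℝ X]

/-- The μ-ball `B(x, α, t) = {y : μ_{x-y}(t) > 1 - α}`. -/
def pmBall (μ : ProbModular X) (x : X) (α t : ℝ) : Set X :=
  {y : X | 1 - α < μ.mu (x - y) t}

/-- Every `μ_x` is left-continuous on `ℝ`. -/
def ProbModular.LeftContinuous (μ : ProbModular X) : Prop :=
  ∀ (x : X) (t : ℝ), ContinuousWithinAt (μ.mu x) (Set.Iic t) t

/-- The Δ₂-condition with constant `c`: `μ_{2x}(t) ≥ μ_x(t/c)` for all `x` and `t > 0`. -/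
def ProbModular.Delta2 (μ : ProbModular X) (c : ℝ) : Prop :=
  ∀ (x : X) (t : ℝ), 0 < t → μ.mu x (t / c) ≤ μ.mu ((2 : ℝ) • x) t

/-- β-homogeneity: `μ_{a x}(t) = μ_x(t / |a|^β)` for all `x`, `t > 0`, nonzero `a`. -/
def ProbModular.IsHomog (μ : ProbModular X) (β : ℝ) : Prop :=
  ∀ (x : X) (t a : ℝ), 0 < t → a ≠ 0 → μ.mu (a • x) t = μ.mu x (t / |a| ^ β)

/-- Condition (Υ): for any nonzero `x`, `μ_x` is continuous on `ℝ` and strictly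
increasing on `{t : 0 < μ_x(t) < 1}`. -/
def ProbModular.Upsilon (μ : ProbModular X) : Prop :=
  ∀ x : X, x ≠ 0 → Continuous (μ.mu x) ∧
    StrictMonoOn (μ.mu x) {t : ℝ | 0 < μ.mu x t ∧ μ.mu x t < 1}

/-- The values of a probabilistic modular are at most `1`. -/
theorem ProbModular.mu_le_one (μ : ProbModular X) (x : X) (t : ℝ) : μ.mu x t ≤ 1 := by
  have hbdd : BddAbove (range (μ.mu x)) := by
    by_contra h
    have h1 := μ.iSup_mu x
    rw [Real.iSup_of_not_bddAbove h] at h1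
    exact zero_ne_one h1
  exact (le_ciSup hbdd t).trans_eq (μ.iSup_mu x)

/-- A nonzero vector has `μ_x(t) < 1` for some `t > 0`. -/
theorem ProbModular.exists_mu_lt_one (μ : ProbModular X) {x : X} (hx : x ≠ 0) :
    ∃ t : ℝ, 0 < t ∧ μ.mu x t < 1 := by
  by_contra! h
  exact hx ((μ.mu_eq_one_iff x).1 fun t ht => (μ.mu_le_one x t).antisymm (h t ht))

/-- Under the Δ₂-condition, the modular satisfies a triangle inequality up to the factor `2c`. -/
theorem ProbModular.Delta2.min_le_mu_add {μ : ProbModular X} {c : ℝ} (hΔ : μ.Delta2 c)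
    (x y : X) {t : ℝ} (ht : 0 < t) :
    min (μ.mu x (t / (2 * c))) (μ.mu y (t / (2 * c))) ≤ μ.mu (x + y) t := by
  have ht2 : 0 < t / 2 := half_pos ht
  have h := μ.mu_convex ((2 : ℝ) • x) ((2 : ℝ) • y) (1 / 2) (1 / 2) (t / 2) (t / 2)
    (by norm_num) (by norm_num) (by norm_num) ht2.le ht2.le
  rw [smul_smul, smul_smul, add_halves, one_div, inv_mul_cancel₀ two_ne_zero, one_smul,
    one_smul] at h
  rw [← div_div]
  exact (min_le_min (hΔ x _ ht2) (hΔ y _ ht2)).trans h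

theorem stmt4 (μ : ProbModular X) (c : ℝ) (hc : 0 < c) (hΔ : μ.Delta2 c)
    (x y : X) (hxy : x ≠ y) :
    ∃ t₀ α₁ : ℝ, 0 < t₀ ∧ μ.mu (x - y) t₀ < α₁ ∧ α₁ < 1 ∧
      Disjoint (pmBall μ x (1 - α₁) (t₀ / (2 * c))) (pmBall μ y (1 - α₁) (t₀ / (2 * c))) := by
  obtain ⟨t₀, ht₀, hlt⟩ := μ.exists_mu_lt_one (sub_ne_zero.2 hxy)
  obtain ⟨α₁, hα, hα1⟩ := exists_between hlt
  refine ⟨t₀, α₁, ht₀, hα, hα1, Set.disjoint_left.2 fun z hzx hzy => ?_⟩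
  rw [pmBall, mem_ofPred_eq, sub_sub_cancel] at hzx hzy
  rw [← μ.mu_neg, neg_sub] at hzy
  have h := hΔ.min_le_mu_add (x - z) (z - y) ht₀
  rw [sub_add_sub_cancel] at h
  exact absurd ((lt_min hzx hzy).trans_le h) hα.not_gt
end

section
/- Let (X, μ) be a β-homogeneous probabilistic modular space (0 < β ≤ 1). For every α ∈ (0,1) and t > 0, there exist α₁, α₂ ∈ (0,1) and t₁, t₂ > 0 such that B(0, α₁, t₁) + B(0, α₂, t₂) ⊆ B(0, α, t), where the sum denotes the Minkowski sum {x + y : x ∈ B(0, α₁, t₁), y ∈ B(0, α₂, t₂)}. -/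
open Set Pointwise

variable {X : Type*} [AddCommGroup X] [Module ℝ X]

theorem stmt10 (μ : ProbModular X) (β : ℝ) (hβ0 : 0 < β) (hβ1 : β ≤ 1)
    (hhom : μ.IsHomog β) (α t : ℝ) (hα : α ∈ Set.Ioo (0 : ℝ) 1) (ht : 0 < t) :
    ∃ α₁ α₂ t₁ t₂ : ℝ, α₁ ∈ Set.Ioo (0 : ℝ) 1 ∧ α₂ ∈ Set.Ioo (0 : ℝ) 1 ∧
      0 < t₁ ∧ 0 < t₂ ∧
      pmBall μ 0 α₁ t₁ + pmBall μ 0 α₂ t₂ ⊆ pmBall μ 0 α t := by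
  have hs : 0 < t / 2 / |(2 : ℝ)| ^ β := by positivity
  refine ⟨α, α, _, _, hα, hα, hs, hs, ?_⟩
  rintro _ ⟨x, hx, y, hy, rfl⟩
  simp only [pmBall, mem_ofPred_eq] at hx hy ⊢
  rw [← hhom _ _ 2 (half_pos ht) two_ne_zero] at hx hy
  have h := μ.mu_convex ((2 : ℝ) • (0 - x)) ((2 : ℝ) • (0 - y)) (1 / 2) (1 / 2) (t / 2) (t / 2)
    (by norm_num) (by norm_num) (by norm_num) (half_pos ht).le (half_pos ht).le
  have hxy : (1 / 2 : ℝ) • (2 : ℝ) • (0 - x) + (1 / 2 : ℝ) • (2 : ℝ) • (0 - y) =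
      0 - (x + y) := by
    module
  rw [hxy, add_halves] at h
  exact (lt_min hx hy).trans_le h
end

section
/- Let (X, μ) be a β-homogeneous probabilistic modular space (0 < β ≤ 1). For every λ ∈ ℝ, α ∈ (0,1), and t > 0, there exist α₁ ∈ (0,1), t₁ > 0, and r > 0 such that for every ξ ∈ ℝ with |ξ − λ| < r and every x ∈ B(0, α₁, t₁), one has ξ·x ∈ B(0, α, t). -/
open Set

variable {X : Type*} [AddCommGroup X] [Module ℝ X]

theorem stmt11 (μ : ProbModular X) (β : ℝ) (hβ0 : 0 < β) (hβ1 : β ≤ 1)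
    (hhom : μ.IsHomog β) (lam α t : ℝ) (hα : α ∈ Set.Ioo (0 : ℝ) 1) (ht : 0 < t) :
    ∃ α₁ t₁ r : ℝ, α₁ ∈ Set.Ioo (0 : ℝ) 1 ∧ 0 < t₁ ∧ 0 < r ∧
      ∀ ξ : ℝ, |ξ - lam| < r → ∀ x ∈ pmBall μ 0 α₁ t₁, ξ • x ∈ pmBall μ 0 α t := by
  have hc : 0 < |lam| + 1 := by positivity
  refine ⟨α, t / (|lam| + 1) ^ β, 1, hα, by positivity, one_pos, fun ξ hξ x hx => ?_⟩
  simp only [pmBall, Set.mem_ofPred_eq, zero_sub, μ.mu_neg] at hx ⊢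
  rcases eq_or_ne ξ 0 with rfl | hξ0
  · rw [zero_smul, (μ.mu_eq_one_iff 0).2 rfl t ht]
    linarith [hα.1]
  · have hle : |ξ| ≤ |lam| + 1 := by
      linarith [abs_sub_abs_le_abs_sub ξ lam]
    have hpos : 0 < |ξ| := abs_pos.2 hξ0
    rw [hhom x t ξ ht hξ0]
    refine hx.trans_le (μ.mono x ?_)
    gcongr
end

section
/- Let (X, μ) be a β-homogeneous probabilistic modular space (0 < β ≤ 1) satisfying condition (Υ). Then there exists a topology on X making X a Hausdorff topological real vector space (addition and scalar multiplication are continuous and the topology is T2) whose neighborhood filter at 0 has the family 𝔖 = {B(0, α, t) : α ∈ (0,1), t > 0} of μ-balls as a basis. -/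
open Set

variable {X : Type*} [AddCommGroup X] [Module ℝ X]

open Filter Topology Pointwise

namespace ProbModular

theorem mem_pmBall_zero (μ : ProbModular X) {α t : ℝ} {y : X} :
    y ∈ pmBall μ 0 α t ↔ 1 - α < μ.mu y t := by
  simp [pmBall, μ.mu_neg]

theorem bddAbove_range_mu (μ : ProbModular X) (x : X) : BddAbove (range (μ.mu x)) := by
  by_contra h
  have h0 : ⨆ t : ℝ, μ.mu x t = 0 := Real.sSup_of_not_bddAbove h
  simp [μ.iSup_mu x] at h0

theorem mu_le_one_s12 (μ : ProbModular X) (x : X) (t : ℝ) : μ.mu x t ≤ 1 :=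
  μ.iSup_mu x ▸ le_ciSup (μ.bddAbove_range_mu x) t

theorem exists_lt_mu (μ : ProbModular X) (x : X) {r : ℝ} (hr : r < 1) : ∃ s, r < μ.mu x s :=
  exists_lt_of_lt_ciSup (hr.trans_eq (μ.iSup_mu x).symm)

theorem pmBall_zero_mono (μ : ProbModular X) {α α' t t' : ℝ} (hα : α ≤ α') (ht : t ≤ t') :
    pmBall μ 0 α t ⊆ pmBall μ 0 α' t' := by
  intro y hy
  rw [mem_pmBall_zero] at hy ⊢
  linarith [μ.mono y ht]

theorem zero_mem_pmBall (μ : ProbModular X) {α t : ℝ} (hα : 0 < α) (ht : 0 < t) :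
    (0 : X) ∈ pmBall μ 0 α t := by
  rw [mem_pmBall_zero, (μ.mu_eq_one_iff 0).2 rfl t ht]
  linarith

theorem neg_mem_pmBall_zero (μ : ProbModular X) {α t : ℝ} {y : X} (hy : y ∈ pmBall μ 0 α t) :
    -y ∈ pmBall μ 0 α t := by
  rw [mem_pmBall_zero] at hy ⊢
  rwa [μ.mu_neg]

theorem exists_notMem_pmBall_zero (μ : ProbModular X) {x : X} (hx : x ≠ 0) :
    ∃ α ∈ Ioo (0 : ℝ) 1, ∃ t, 0 < t ∧ x ∉ pmBall μ 0 α t := by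
  have h := mt (μ.mu_eq_one_iff x).1 hx
  push Not at h
  obtain ⟨t, ht, hxt⟩ := h
  have hlt := lt_of_le_of_ne (μ.mu_le_one_s12 x t) hxt
  have h0 : 0 ≤ μ.mu x t := μ.mu_zero x ▸ μ.mono x ht.le
  refine ⟨(1 - μ.mu x t) / 2, ⟨by linarith, by linarith⟩, t, ht, ?_⟩
  rw [mem_pmBall_zero]
  linarith

namespace IsHomog

variable {μ : ProbModular X} {β : ℝ}

theorem add_mem_pmBall_zero (h : μ.IsHomog β) {α t : ℝ} (ht : 0 < t) {x y : X}
    (hx : x ∈ pmBall μ 0 α (t / 2 / |2| ^ β)) (hy : y ∈ pmBall μ 0 α (t / 2 / |2| ^ β)) :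
    x + y ∈ pmBall μ 0 α t := by
  rw [mem_pmBall_zero] at *
  rw [← h _ _ 2 (half_pos ht) two_ne_zero] at hx hy
  have key := μ.mu_convex ((2 : ℝ) • x) ((2 : ℝ) • y) (1 / 2) (1 / 2) (t / 2) (t / 2)
    (by norm_num) (by norm_num) (by norm_num) (half_pos ht).le (half_pos ht).le
  simp only [smul_smul, add_halves] at key
  norm_num at key
  rcases key with key | key
  · exact hx.trans_le key
  · exact hy.trans_le key

theorem smul_mem_pmBall_zero_iff (h : μ.IsHomog β) {α t a : ℝ} (ht : 0 < t) (ha : a ≠ 0) {x : X} :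
    a • x ∈ pmBall μ 0 α t ↔ x ∈ pmBall μ 0 α (t / |a| ^ β) := by
  rw [mem_pmBall_zero, mem_pmBall_zero, h x t a ht ha]

theorem smul_mem_pmBall_zero (h : μ.IsHomog β) {α s t a : ℝ} (hα : 0 < α) (ht : 0 < t) {x : X}
    (hx : x ∈ pmBall μ 0 α s) (hs : s * |a| ^ β ≤ t) : a • x ∈ pmBall μ 0 α t := by
  rcases eq_or_ne a 0 with rfl | ha
  · simpa using μ.zero_mem_pmBall hα ht
  · rw [h.smul_mem_pmBall_zero_iff ht ha]
    exact μ.pmBall_zero_mono le_rfl ((le_div_iff₀ (by positivity)).2 hs) hx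

theorem eventually_smul_mem_pmBall_zero (h : μ.IsHomog β) (hβ : 0 < β) {α t : ℝ} (hα : 0 < α)
    (ht : 0 < t) (x : X) : ∀ᶠ a in 𝓝 (0 : ℝ), a • x ∈ pmBall μ 0 α t := by
  obtain ⟨s, hs⟩ := μ.exists_lt_mu x (r := 1 - α) (by linarith)
  have hlim : Tendsto (fun a : ℝ ↦ s * |a| ^ β) (𝓝 0) (𝓝 0) := by
    have hc : Continuous fun a : ℝ ↦ s * |a| ^ β :=
      continuous_const.mul (continuous_abs.rpow_const fun _ ↦ Or.inr hβ.le)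
    simpa [Real.zero_rpow hβ.ne'] using hc.tendsto 0
  filter_upwards [hlim.eventually_lt_const ht] with a ha
  exact h.smul_mem_pmBall_zero hα ht (μ.mem_pmBall_zero.2 hs) ha.le

/-- The `μ`-balls around zero of a homogeneous probabilistic modular, as a module filter basis. -/
def moduleFilterBasis (h : μ.IsHomog β) (hβ : 0 < β) : ModuleFilterBasis ℝ X where
  toAddGroupFilterBasis := addGroupFilterBasisOfComm
    {U | ∃ α ∈ Ioo (0 : ℝ) 1, ∃ t, 0 < t ∧ pmBall μ 0 α t = U}
    ⟨_, 1 / 2, by norm_num, 1, one_pos, rfl⟩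
    (by
      rintro _ _ ⟨α, hα, t, ht, rfl⟩ ⟨α', hα', t', ht', rfl⟩
      exact ⟨_, ⟨min α α', ⟨lt_min hα.1 hα'.1, min_lt_of_left_lt hα.2⟩, min t t',
        lt_min ht ht', rfl⟩, subset_inter
          (μ.pmBall_zero_mono (min_le_left _ _) (min_le_left _ _))
          (μ.pmBall_zero_mono (min_le_right _ _) (min_le_right _ _))⟩)
    (by
      rintro _ ⟨α, hα, t, ht, rfl⟩
      exact μ.zero_mem_pmBall hα.1 ht)
    (by
      rintro _ ⟨α, hα, t, ht, rfl⟩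
      exact ⟨_, ⟨α, hα, t / 2 / |2| ^ β, by positivity, rfl⟩,
        add_subset_iff.2 fun x hx y hy ↦ h.add_mem_pmBall_zero ht hx hy⟩)
    (by
      rintro _ ⟨α, hα, t, ht, rfl⟩
      exact ⟨_, ⟨α, hα, t, ht, rfl⟩, fun x hx ↦ μ.neg_mem_pmBall_zero hx⟩)
  smul' := by
    rintro _ ⟨α, hα, t, ht, rfl⟩
    refine ⟨Metric.closedBall 0 1, Metric.closedBall_mem_nhds _ one_pos, _,
      ⟨α, hα, t, ht, rfl⟩, smul_subset_iff.2 fun a ha x hx ↦ ?_⟩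
    rw [mem_closedBall_zero_iff, Real.norm_eq_abs] at ha
    exact h.smul_mem_pmBall_zero hα.1 ht hx
      (mul_le_of_le_one_right ht.le (Real.rpow_le_one (abs_nonneg a) ha hβ.le))
  smul_left' := by
    rintro a _ ⟨α, hα, t, ht, rfl⟩
    have hpos : 0 < |a| ^ β + 1 := by positivity
    refine ⟨_, ⟨α, hα, t / (|a| ^ β + 1), by positivity, rfl⟩, fun x hx ↦
      h.smul_mem_pmBall_zero hα.1 ht hx ?_⟩
    rw [div_mul_eq_mul_div, div_le_iff₀ hpos]
    gcongr
    linarith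
  smul_right' := by
    rintro x _ ⟨α, hα, t, ht, rfl⟩
    exact h.eventually_smul_mem_pmBall_zero hβ hα.1 ht x

theorem mem_moduleFilterBasis (h : μ.IsHomog β) (hβ : 0 < β) {U : Set X} :
    U ∈ (h.moduleFilterBasis hβ).sets ↔
      ∃ α ∈ Ioo (0 : ℝ) 1, ∃ t, 0 < t ∧ pmBall μ 0 α t = U :=
  Iff.rfl

end IsHomog

end ProbModular

theorem stmt12 (μ : ProbModular X) (β : ℝ) (hβ0 : 0 < β) (hβ1 : β ≤ 1)
    (hhom : μ.IsHomog β) (hups : μ.Upsilon) :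
    ∃ τ : TopologicalSpace X,
      @T2Space X τ ∧ @ContinuousAdd X τ _ ∧ @ContinuousSMul ℝ X _ _ τ ∧
      (@nhds X τ 0).HasBasis
        (fun p : ℝ × ℝ => p.1 ∈ Set.Ioo (0 : ℝ) 1 ∧ 0 < p.2)
        (fun p : ℝ × ℝ => pmBall μ 0 p.1 p.2) := by
  let B := hhom.moduleFilterBasis hβ0
  let : TopologicalSpace X := B.topology
  have : IsTopologicalAddGroup X := B.toAddGroupFilterBasis.isTopologicalAddGroup
  refine ⟨B.topology, ?_, inferInstance, B.continuousSMul, ?_⟩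
  · refine (B.toAddGroupFilterBasis.t2Space_iff_sInter_subset rfl).2 fun x hx ↦ ?_
    by_contra hne
    obtain ⟨α, hα, t, ht, hxt⟩ := μ.exists_notMem_pmBall_zero hne
    exact hxt (hx _ ((hhom.mem_moduleFilterBasis hβ0).2 ⟨α, hα, t, ht, rfl⟩))
  · refine B.toAddGroupFilterBasis.nhds_zero_hasBasis.to_hasBasis ?_ ?_
    · rintro _ ⟨α, hα, t, ht, rfl⟩
      exact ⟨(α, t), ⟨hα, ht⟩, Subset.rfl⟩
    · rintro ⟨α, t⟩ ⟨hα, ht⟩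
      exact ⟨_, ⟨α, hα, t, ht, rfl⟩, Subset.rfl⟩
end
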